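/- Let n be a positive integer and let H be a finite group having both property T(n,SK) and property T(n,GK). Consider the action of H on the set of group homomorphisms G_n(SK) → H by conjugation (h · ρ is the map x ↦ h ρ(x) h^{-1}), and likewise on the set of group homomorphisms G_n(GK) → H. Then the number of orbits (conjugacy classes of homomorphisms) of the first action equals the number of orbits of the second action. -/

import Mathlib

/-- Relators of G₁(SK) = ⟨B, D, E | B D B = D B D, E D E = D E D⟩, with B, D, E = 0, 1, 2. -/
def G1SKRels : Set (FreeGroup (Fin 3)) :=
  let B : FreeGroup (Fin 3) := FreeGroup.of 0
  let D : FreeGroup (Fin 3) := FreeGroup.of 1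
  let E : FreeGroup (Fin 3) := FreeGroup.of 2
  {B * D * B * (D * B * D)⁻¹,
   E * D * E * (D * E * D)⁻¹}

/-- The knot group of the square knot (= that of the granny knot). -/
abbrev G1SK := PresentedGroup G1SKRels

/-- Relators of the n-th generalized knot group of the square knot:
⟨b, d, e | b dⁿ bⁿ = dⁿ bⁿ d, e dⁿ eⁿ = dⁿ eⁿ d, eⁿ dⁿ e d⁻ⁿ e⁻ⁿ = bⁿ dⁿ b d⁻ⁿ b⁻ⁿ⟩,
with b, d, e = 0, 1, 2. -/
def GnSKRels (n : ℕ) : Set (FreeGroup (Fin 3)) :=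
  let b : FreeGroup (Fin 3) := FreeGroup.of 0
  let d : FreeGroup (Fin 3) := FreeGroup.of 1
  let e : FreeGroup (Fin 3) := FreeGroup.of 2
  {b * d ^ n * b ^ n * (d ^ n * b ^ n * d)⁻¹,
   e * d ^ n * e ^ n * (d ^ n * e ^ n * d)⁻¹,
   e ^ n * d ^ n * e * (d ^ n)⁻¹ * (e ^ n)⁻¹ * (b ^ n * d ^ n * b * (d ^ n)⁻¹ * (b ^ n)⁻¹)⁻¹}

/-- The n-th generalized knot group of the square knot. -/
abbrev GnSK (n : ℕ) := PresentedGroup (GnSKRels n)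

/-- Relators of the n-th generalized knot group of the granny knot:
⟨b, d, e | b dⁿ bⁿ = dⁿ bⁿ d, d eⁿ dⁿ = eⁿ dⁿ e, e⁻ⁿ d⁻ⁿ e dⁿ eⁿ = bⁿ dⁿ b d⁻ⁿ b⁻ⁿ⟩,
with b, d, e = 0, 1, 2. -/
def GnGKRels (n : ℕ) : Set (FreeGroup (Fin 3)) :=
  let b : FreeGroup (Fin 3) := FreeGroup.of 0
  let d : FreeGroup (Fin 3) := FreeGroup.of 1
  let e : FreeGroup (Fin 3) := FreeGroup.of 2
  {b * d ^ n * b ^ n * (d ^ n * b ^ n * d)⁻¹,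
   d * e ^ n * d ^ n * (e ^ n * d ^ n * e)⁻¹,
   (e ^ n)⁻¹ * (d ^ n)⁻¹ * e * d ^ n * e ^ n * (b ^ n * d ^ n * b * (d ^ n)⁻¹ * (b ^ n)⁻¹)⁻¹}

/-- The n-th generalized knot group of the granny knot. -/
abbrev GnGK (n : ℕ) := PresentedGroup (GnGKRels n)

/-- A group `H` has property T(n,SK) if for every homomorphism ρ : G₁(SK) → H and every
g ∈ H with gⁿ = ρ(D), one has (ρ(E)ρ(D))³ g (ρ(E)ρ(D))⁻³ = (ρ(B)ρ(D))³ g (ρ(B)ρ(D))⁻³. -/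
def PropertyTSK (n : ℕ) (H : Type*) [Group H] : Prop :=
  ∀ (ρ : G1SK →* H) (g : H), g ^ n = ρ (PresentedGroup.of 1) →
    (ρ (PresentedGroup.of 2) * ρ (PresentedGroup.of 1)) ^ 3 * g *
      ((ρ (PresentedGroup.of 2) * ρ (PresentedGroup.of 1)) ^ 3)⁻¹ =
    (ρ (PresentedGroup.of 0) * ρ (PresentedGroup.of 1)) ^ 3 * g *
      ((ρ (PresentedGroup.of 0) * ρ (PresentedGroup.of 1)) ^ 3)⁻¹

/-- A group `H` has property T(n,GK) if for every homomorphism ρ : G₁(SK) → H and every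
g ∈ H with gⁿ = ρ(D), setting b̂ = ρ(D) ρ(B) g ρ(B)⁻¹ ρ(D)⁻¹ and
ê = ρ(D)⁻¹ ρ(E)⁻¹ g ρ(E) ρ(D), one has ρ(E)⁻¹ ρ(D)⁻¹ ê ρ(D) ρ(E) = ρ(B) ρ(D) b̂ ρ(D)⁻¹ ρ(B)⁻¹. -/
def PropertyTGK (n : ℕ) (H : Type*) [Group H] : Prop :=
  ∀ (ρ : G1SK →* H) (g : H), g ^ n = ρ (PresentedGroup.of 1) →
    ∀ bhat ehat : H,
      bhat = ρ (PresentedGroup.of 1) * ρ (PresentedGroup.of 0) * g *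
        (ρ (PresentedGroup.of 0))⁻¹ * (ρ (PresentedGroup.of 1))⁻¹ →
      ehat = (ρ (PresentedGroup.of 1))⁻¹ * (ρ (PresentedGroup.of 2))⁻¹ * g *
        ρ (PresentedGroup.of 2) * ρ (PresentedGroup.of 1) →
      (ρ (PresentedGroup.of 2))⁻¹ * (ρ (PresentedGroup.of 1))⁻¹ * ehat *
          ρ (PresentedGroup.of 1) * ρ (PresentedGroup.of 2) =
        ρ (PresentedGroup.of 0) * ρ (PresentedGroup.of 1) * bhat *
          (ρ (PresentedGroup.of 1))⁻¹ * (ρ (PresentedGroup.of 0))⁻¹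


/-- Two homomorphisms into `H` are conjugate when one is obtained from the other by
composing with conjugation by some `h ∈ H` (the conjugation action `(h • ρ) x = h ρ(x) h⁻¹`). -/
def ConjRel {G H : Type*} [Group G] [Group H] (ρ₁ ρ₂ : G →* H) : Prop :=
  ∃ h : H, ∀ x : G, ρ₁ x = h * ρ₂ x * h⁻¹

section Helpers

variable {H : Type*} [Group H]

/-- The triples defining homomorphisms from the square knot group. -/
def IsSK (n : ℕ) (b d e : H) : Prop :=
  b * d ^ n * b ^ n = d ^ n * b ^ n * d ∧ e * d ^ n * e ^ n = d ^ n * e ^ n * d ∧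
  e ^ n * d ^ n * e * (d ^ n)⁻¹ * (e ^ n)⁻¹ = b ^ n * d ^ n * b * (d ^ n)⁻¹ * (b ^ n)⁻¹

/-- The triples defining homomorphisms from the granny knot group. -/
def IsGK (n : ℕ) (b d e : H) : Prop :=
  b * d ^ n * b ^ n = d ^ n * b ^ n * d ∧ d * e ^ n * d ^ n = e ^ n * d ^ n * e ∧
  (e ^ n)⁻¹ * (d ^ n)⁻¹ * e * d ^ n * e ^ n = b ^ n * d ^ n * b * (d ^ n)⁻¹ * (b ^ n)⁻¹

lemma braid_left {n : ℕ} {b d : H} (h : b * d ^ n * b ^ n = d ^ n * b ^ n * d) :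
    b ^ n * d ^ n * b ^ n = d ^ n * b ^ n * d ^ n := by
  have h1 : b = (d ^ n * b ^ n) * d * (d ^ n * b ^ n)⁻¹ := by
    rw [← h]; group
  have h2 : b ^ n = (d ^ n * b ^ n) * d ^ n * (d ^ n * b ^ n)⁻¹ := by
    rw [← conj_pow, ← h1]
  rw [mul_assoc]
  exact eq_mul_inv_iff_mul_eq.mp h2

lemma braid_right {n : ℕ} {e d : H} (h : d * e ^ n * d ^ n = e ^ n * d ^ n * e) :
    e ^ n * d ^ n * e ^ n = d ^ n * e ^ n * d ^ n := (braid_left h).symm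

/-- The homomorphism out of the knot group given by a triple. -/
def homG1 (B D E : H) (h1 : B * D * B = D * B * D) (h2 : E * D * E = D * E * D) : G1SK →* H :=
  PresentedGroup.toGroup (f := ![B, D, E]) (by
    intro r hr
    rcases hr with rfl | rfl
    · simp [h1]
    · simp [h2])

/-- The homomorphism out of the square knot group given by a triple. -/
def homSK {n : ℕ} {b d e : H} (h : IsSK n b d e) : GnSK n →* H :=
  PresentedGroup.toGroup (f := ![b, d, e]) (by
    obtain ⟨h1, h2, h3⟩ := h
    intro r hr
    rcases hr with rfl | rfl | rfl
    · rw [map_mul, map_inv, mul_inv_eq_one]; simpa using h1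
    · rw [map_mul, map_inv, mul_inv_eq_one]; simpa using h2
    · rw [map_mul, map_inv, mul_inv_eq_one]; simpa using h3)

/-- The homomorphism out of the granny knot group given by a triple. -/
def homGK {n : ℕ} {b d e : H} (h : IsGK n b d e) : GnGK n →* H :=
  PresentedGroup.toGroup (f := ![b, d, e]) (by
    obtain ⟨h1, h2, h3⟩ := h
    intro r hr
    rcases hr with rfl | rfl | rfl
    · rw [map_mul, map_inv, mul_inv_eq_one]; simpa using h1
    · rw [map_mul, map_inv, mul_inv_eq_one]; simpa using h2
    · rw [map_mul, map_inv, mul_inv_eq_one]; simpa using h3)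

lemma isSK_of_hom {n : ℕ} (ρ : GnSK n →* H) :
    IsSK n (ρ (PresentedGroup.of 0)) (ρ (PresentedGroup.of 1)) (ρ (PresentedGroup.of 2)) := by
  have key : ∀ r ∈ GnSKRels n, ρ (PresentedGroup.mk _ r) = 1 := fun r hr => by
    rw [PresentedGroup.one_of_mem hr, map_one]
  refine ⟨?_, ?_, ?_⟩
  · have := key _ (Or.inl rfl)
    rw [map_mul, map_mul, map_inv, map_inv, mul_inv_eq_one] at this
    simpa [PresentedGroup.of] using this
  · have := key _ (Or.inr (Or.inl rfl))
    rw [map_mul, map_mul, map_inv, map_inv, mul_inv_eq_one] at this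
    simpa [PresentedGroup.of] using this
  · have := key _ (Or.inr (Or.inr rfl))
    rw [map_mul, map_mul, map_inv, map_inv, mul_inv_eq_one] at this
    simpa [PresentedGroup.of] using this

lemma isGK_of_hom {n : ℕ} (ρ : GnGK n →* H) :
    IsGK n (ρ (PresentedGroup.of 0)) (ρ (PresentedGroup.of 1)) (ρ (PresentedGroup.of 2)) := by
  have key : ∀ r ∈ GnGKRels n, ρ (PresentedGroup.mk _ r) = 1 := fun r hr => by
    rw [PresentedGroup.one_of_mem hr, map_one]
  refine ⟨?_, ?_, ?_⟩
  · have := key _ (Or.inl rfl)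
    rw [map_mul, map_mul, map_inv, map_inv, mul_inv_eq_one] at this
    simpa [PresentedGroup.of] using this
  · have := key _ (Or.inr (Or.inl rfl))
    rw [map_mul, map_mul, map_inv, map_inv, mul_inv_eq_one] at this
    simpa [PresentedGroup.of] using this
  · have := key _ (Or.inr (Or.inr rfl))
    rw [map_mul, map_mul, map_inv, map_inv, mul_inv_eq_one] at this
    simpa [PresentedGroup.of] using this

/-- New third generator, from square to granny. -/
def toE (n : ℕ) (d e : H) : H := (e ^ n * d ^ n)⁻¹ * d * (e ^ n * d ^ n)

/-- New third generator, from granny to square. -/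
def fromE (n : ℕ) (d e : H) : H := (d ^ n * e ^ n) * d * (d ^ n * e ^ n)⁻¹

lemma toE_pow {n : ℕ} {d e : H} (h : e ^ n * d ^ n * e ^ n = d ^ n * e ^ n * d ^ n) :
    toE n d e ^ n = e ^ n := by
  have : toE n d e ^ n = (e ^ n * d ^ n)⁻¹ * d ^ n * (e ^ n * d ^ n) := by
    have := conj_pow (i := n) (a := (e ^ n * d ^ n)⁻¹) (b := d)
    rwa [inv_inv] at this
  rw [this, mul_assoc, inv_mul_eq_iff_eq_mul, ← mul_assoc, h]

lemma fromE_pow {n : ℕ} {d e : H} (h : e ^ n * d ^ n * e ^ n = d ^ n * e ^ n * d ^ n) :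
    fromE n d e ^ n = e ^ n := by
  rw [fromE, conj_pow, mul_inv_eq_iff_eq_mul, ← mul_assoc, h]

lemma eq_fromE {n : ℕ} {d e : H} (h : e * d ^ n * e ^ n = d ^ n * e ^ n * d) :
    fromE n d e = e := by
  rw [fromE, mul_inv_eq_iff_eq_mul, ← mul_assoc, h]

lemma eq_toE {n : ℕ} {d e : H} (h : d * e ^ n * d ^ n = e ^ n * d ^ n * e) :
    toE n d e = e := by
  rw [toE, mul_assoc, inv_mul_eq_iff_eq_mul, ← mul_assoc, h]

lemma isGK_toE {n : ℕ} (hT : PropertyTGK n H) {b d e : H} (h : IsSK n b d e) :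
    IsGK n b d (toE n d e) := by
  obtain ⟨h1, h2, -⟩ := h
  have k1 := braid_left h1
  have k2 := braid_left h2
  have hp := toE_pow k2
  refine ⟨h1, ?_, ?_⟩
  · rw [hp, toE]; group
  · rw [hp]
    have := hT (homG1 _ _ _ k1 k2) d (by simp [homG1]) b (toE n d e)
      (by simp only [homG1, PresentedGroup.toGroup.of]
          have := eq_fromE h1
          simp [fromE, mul_assoc] at this ⊢
          exact this.symm)
      (by simp [homG1, toE, mul_assoc])
    simpa [homG1] using this

lemma isSK_fromE {n : ℕ} (hT : PropertyTSK n H) {b d e : H} (h : IsGK n b d e) :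
    IsSK n b d (fromE n d e) := by
  obtain ⟨h1, h2, -⟩ := h
  have k1 := braid_left h1
  have k2 := braid_right h2
  have hp := fromE_pow k2
  refine ⟨h1, ?_, ?_⟩
  · rw [hp, fromE]; group
  · rw [hp]
    have := hT (homG1 _ _ _ k1 k2) d (by simp [homG1])
    simp only [homG1, PresentedGroup.toGroup.of, Matrix.cons_val] at this
    have aux : ∀ B : H, B * d ^ n * B = d ^ n * B * d ^ n →
        (B * d ^ n) ^ 3 * d * ((B * d ^ n) ^ 3)⁻¹ =
        B * d ^ n * ((d ^ n * B) * d * (d ^ n * B)⁻¹) * (d ^ n)⁻¹ * B⁻¹ := by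
      intro B hB
      have e1 : (B * d ^ n) ^ 3 = B * d ^ n * d ^ n * B * (d ^ n * d ^ n) := by
        calc (B * d ^ n) ^ 3 = B * d ^ n * (B * d ^ n * B) * d ^ n := by
              simp only [pow_succ, pow_zero, one_mul, mul_assoc]
          _ = _ := by rw [hB]; simp only [mul_assoc]
      rw [e1]
      group
    rw [aux _ k1, aux _ k2] at this
    have hb := eq_fromE h1
    change _ = b ^ n * d ^ n * fromE n d b * _ * _ at this
    rw [hb] at this
    exact this

lemma conjRel_of_gens {rels : Set (FreeGroup (Fin 3))} {ρ₁ ρ₂ : PresentedGroup rels →* H} (h : H)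
    (h0 : ∀ i, ρ₁ (PresentedGroup.of i) = h * ρ₂ (PresentedGroup.of i) * h⁻¹) :
    ConjRel ρ₁ ρ₂ := by
  refine ⟨h, ?_⟩
  have : ρ₁ = (MulAut.conj h).toMonoidHom.comp ρ₂ := by
    apply PresentedGroup.ext
    intro i
    simpa using h0 i
  intro x
  rw [this]; simp

/-- From homs of the square group to homs of the granny group. -/
def fwdHom {n : ℕ} (hT : PropertyTGK n H) (ρ : GnSK n →* H) : GnGK n →* H :=
  homGK (isGK_toE hT (isSK_of_hom ρ))

/-- From homs of the granny group to homs of the square group. -/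
def invHom {n : ℕ} (hT : PropertyTSK n H) (ρ : GnGK n →* H) : GnSK n →* H :=
  homSK (isSK_fromE hT (isGK_of_hom ρ))

lemma toE_conj (n : ℕ) (h d e : H) :
    toE n (h * d * h⁻¹) (h * e * h⁻¹) = h * toE n d e * h⁻¹ := by
  simp only [toE, conj_pow]; group

lemma fromE_conj (n : ℕ) (h d e : H) :
    fromE n (h * d * h⁻¹) (h * e * h⁻¹) = h * fromE n d e * h⁻¹ := by
  simp only [fromE, conj_pow]; group

lemma fwdHom_conj {n : ℕ} (hT : PropertyTGK n H) {ρ₁ ρ₂ : GnSK n →* H} (h : ConjRel ρ₁ ρ₂) :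
    ConjRel (fwdHom hT ρ₁) (fwdHom hT ρ₂) := by
  obtain ⟨h, hh⟩ := h
  refine conjRel_of_gens h fun i => ?_
  simp only [fwdHom, homGK, PresentedGroup.toGroup.of]
  fin_cases i
  · exact hh _
  · exact hh _
  · change toE n _ _ = h * toE n _ _ * h⁻¹
    rw [hh, hh, toE_conj]

lemma invHom_conj {n : ℕ} (hT : PropertyTSK n H) {ρ₁ ρ₂ : GnGK n →* H} (h : ConjRel ρ₁ ρ₂) :
    ConjRel (invHom hT ρ₁) (invHom hT ρ₂) := by
  obtain ⟨h, hh⟩ := h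
  refine conjRel_of_gens h fun i => ?_
  simp only [invHom, homSK, PresentedGroup.toGroup.of]
  fin_cases i
  · exact hh _
  · exact hh _
  · change fromE n _ _ = h * fromE n _ _ * h⁻¹
    rw [hh, hh, fromE_conj]

lemma invHom_fwdHom {n : ℕ} (hS : PropertyTSK n H) (hG : PropertyTGK n H) (ρ : GnSK n →* H) :
    invHom hS (fwdHom hG ρ) = ρ := by
  apply PresentedGroup.ext
  intro i
  simp only [invHom, homSK, fwdHom, homGK, PresentedGroup.toGroup.of]
  have hρ := (isSK_of_hom ρ).2.1
  fin_cases i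
  · rfl
  · rfl
  · change fromE n (ρ (PresentedGroup.of 1)) (toE n _ _) = _
    rw [fromE, toE_pow (braid_left hρ)]
    exact eq_fromE hρ

lemma fwdHom_invHom {n : ℕ} (hS : PropertyTSK n H) (hG : PropertyTGK n H) (ρ : GnGK n →* H) :
    fwdHom hG (invHom hS ρ) = ρ := by
  apply PresentedGroup.ext
  intro i
  simp only [invHom, homSK, fwdHom, homGK, PresentedGroup.toGroup.of]
  have hρ := (isGK_of_hom ρ).2.1
  fin_cases i
  · rfl
  · rfl
  · change toE n (ρ (PresentedGroup.of 1)) (fromE n _ _) = _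
    rw [toE, fromE_pow (braid_right hρ)]
    exact eq_toE hρ

end Helpers

theorem stmt_15 (n : ℕ) (hn : 0 < n) (H : Type*) [Group H] [Finite H]
    (hTSK : PropertyTSK n H) (hTGK : PropertyTGK n H) :
    Nat.card (Quot (ConjRel (G := GnSK n) (H := H))) =
      Nat.card (Quot (ConjRel (G := GnGK n) (H := H))) := by
  refine Nat.card_congr (Quot.congr
    ⟨fwdHom hTGK, invHom hTSK, invHom_fwdHom hTSK hTGK, fwdHom_invHom hTSK hTGK⟩ fun ρ₁ ρ₂ => ⟨fwdHom_conj hTGK, fun h => ?_⟩)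
  have := invHom_conj hTSK h
  simpa only [Equiv.coe_fn_mk, invHom_fwdHom] using this
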